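/- Let 0<q<1 and let α be a real number with α≥1. Then the reciprocal function 1/f_{α,1}(x;q), where f_{α,1}(x;q) = Γ_q(x+1)·exp(−Li₂(1−q^x)/log q) / ((1−q^x)/(1−q))^{x+1−α}, is logarithmically completely monotonic on (0,∞); that is, for every integer n≥1 and every x>0, (−1)^n (−log f_{α,1}(·;q))^{(n)}(x) ≥ 0. -/

import Mathlib

/-- The `q`-gamma function for `0 < q < 1`:
`Γ_q(x) = (1−q)^(1−x) ∏_{j=0}^∞ (1−q^(j+1))/(1−q^(j+x))`. -/
noncomputable def qGamma (q x : ℝ) : ℝ :=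
  (1 - q) ^ (1 - x) * ∏' j : ℕ, (1 - q ^ (j + 1)) / (1 - q ^ ((j : ℝ) + x))

/-- The dilogarithm `Li₂(z) = −∫₀^z log(1−t)/t dt`. -/
noncomputable def dilog (z : ℝ) : ℝ := -∫ t in (0:ℝ)..z, Real.log (1 - t) / t

/-- The function `f_{α,β}(x;q) = Γ_q(x+β)·exp(−Li₂(1−q^x)/log q) / ((1−q^x)/(1−q))^(x+β−α)`. -/
noncomputable def qf (α β q x : ℝ) : ℝ :=
  qGamma q (x + β) * Real.exp (-dilog (1 - q ^ x) / Real.log q) /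
    ((1 - q ^ x) / (1 - q)) ^ (x + β - α)

open Filter Topology

/-- The series `∑ c_k q^((k+1)x)` in powers of `q^x`. -/
noncomputable def qPowSeries (c : ℕ → ℝ) (q x : ℝ) : ℝ := ∑' k : ℕ, c k * (q ^ x) ^ (k + 1)

lemma rpow_mem_Ioo {q x : ℝ} (hq0 : 0 < q) (hq1 : q < 1) (hx : 0 < x) :
    0 < q ^ x ∧ q ^ x < 1 :=
  ⟨Real.rpow_pos_of_pos hq0 x, Real.rpow_lt_one hq0.le hq1 hx⟩

lemma summable_succ_pow_mul_pow {y : ℝ} (hy0 : 0 ≤ y) (hy1 : y < 1) (C : ℝ) (m : ℕ) :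
    Summable fun k : ℕ => C * ((k : ℝ) + 1) ^ m * y ^ (k + 1) := by
  have h := summable_pow_mul_geometric_of_norm_lt_one m
    (show ‖y‖ < 1 by rwa [Real.norm_of_nonneg hy0])
  have h1 := ((summable_nat_add_iff 1).2 h).mul_left C
  simpa [mul_assoc] using h1

lemma summable_mul_pow_of_bound {c : ℕ → ℝ} {C : ℝ} {m : ℕ} {y : ℝ}
    (hc : ∀ k : ℕ, |c k| ≤ C * ((k : ℝ) + 1) ^ m) (hy0 : 0 ≤ y) (hy1 : y < 1) :
    Summable fun k : ℕ => c k * y ^ (k + 1) := by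
  refine (summable_succ_pow_mul_pow hy0 hy1 C m).of_norm_bounded fun k => ?_
  rw [norm_mul, Real.norm_eq_abs, Real.norm_of_nonneg (pow_nonneg hy0 _)]
  exact mul_le_mul_of_nonneg_right (hc k) (pow_nonneg hy0 _)

lemma hasDerivAt_qPowSeries {c : ℕ → ℝ} {C : ℝ} {m : ℕ} {q x : ℝ}
    (hc : ∀ k : ℕ, |c k| ≤ C * ((k : ℝ) + 1) ^ m) (hq0 : 0 < q) (hq1 : q < 1) (hx : 0 < x) :
    HasDerivAt (qPowSeries c q) (qPowSeries (fun k => Real.log q * (k + 1) * c k) q x) x := by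
  obtain ⟨hh0, hh1⟩ := rpow_mem_Ioo hq0 hq1 (half_pos hx)
  obtain ⟨hy0, hy1⟩ := rpow_mem_Ioo hq0 hq1 hx
  refine hasDerivAt_tsum_of_isPreconnected (t := Set.Ioi (x / 2)) (y₀ := x)
    (g := fun k t => c k * (q ^ t) ^ (k + 1))
    (g' := fun k t => Real.log q * (k + 1) * c k * (q ^ t) ^ (k + 1))
    (summable_succ_pow_mul_pow hh0.le hh1 (|Real.log q| * C) (m + 1)) isOpen_Ioi
    isPreconnected_Ioi ?_ ?_ (Set.mem_Ioi.2 (half_lt_self hx))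
    (summable_mul_pow_of_bound hc hy0.le hy1) (Set.mem_Ioi.2 (half_lt_self hx))
  · intro k y _
    convert! (((hasDerivAt_id y).const_rpow hq0).pow (k + 1)).const_mul (c k) using 1
    simp only [id, Nat.add_sub_cancel]
    push_cast
    ring
  · intro k y hy
    have hqy := Real.rpow_pos_of_pos hq0 y
    have hle : q ^ y ≤ q ^ (x / 2) :=
      Real.rpow_le_rpow_of_exponent_ge hq0 hq1.le (le_of_lt hy)
    have hk : (0 : ℝ) ≤ (k : ℝ) + 1 := by positivity
    rw [norm_mul, norm_mul, norm_mul, Real.norm_of_nonneg (pow_nonneg hqy.le _),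
      Real.norm_of_nonneg hk, Real.norm_eq_abs, Real.norm_eq_abs]
    calc |Real.log q| * (k + 1) * |c k| * (q ^ y) ^ (k + 1)
        ≤ |Real.log q| * (k + 1) * (C * ((k : ℝ) + 1) ^ m) * (q ^ (x / 2)) ^ (k + 1) := by
          have := hc k
          have h0 := (abs_nonneg _).trans this
          gcongr
      _ = |Real.log q| * C * ((k : ℝ) + 1) ^ (m + 1) * (q ^ (x / 2)) ^ (k + 1) := by ring

lemma iteratedDeriv_qPowSeries {q : ℝ} (hq0 : 0 < q) (hq1 : q < 1) (n : ℕ) :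
    ∀ {c : ℕ → ℝ} {C : ℝ} {m : ℕ}, (∀ k : ℕ, |c k| ≤ C * ((k : ℝ) + 1) ^ m) →
      ∀ {x : ℝ}, 0 < x → iteratedDeriv n (qPowSeries c q) x =
        qPowSeries (fun k => (Real.log q * (k + 1)) ^ n * c k) q x := by
  induction n with
  | zero => intro c C m _ x _; simp
  | succ n ih =>
    intro c C m hc x hx
    have hc' : ∀ k : ℕ, |Real.log q * (k + 1) * c k| ≤
        |Real.log q| * C * ((k : ℝ) + 1) ^ (m + 1) := by
      intro k
      have hk : (0 : ℝ) ≤ (k : ℝ) + 1 := by positivity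
      rw [abs_mul, abs_mul, abs_of_nonneg hk]
      calc |Real.log q| * (k + 1) * |c k|
          ≤ |Real.log q| * (k + 1) * (C * ((k : ℝ) + 1) ^ m) := by gcongr; exact hc k
        _ = _ := by ring
    have hev : deriv (qPowSeries c q) =ᶠ[𝓝 x]
        qPowSeries (fun k => Real.log q * (k + 1) * c k) q := by
      filter_upwards [lt_mem_nhds hx] with t ht
      exact (hasDerivAt_qPowSeries hc hq0 hq1 ht).deriv
    rw [iteratedDeriv_succ', hev.iteratedDeriv_eq, ih hc' hx]
    congr 1
    ext k
    ring

lemma neg_one_pow_mul_iteratedDeriv_qPowSeries_nonneg {c : ℕ → ℝ} {C : ℝ} {m : ℕ} {q x : ℝ}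
    (hc0 : ∀ k, 0 ≤ c k) (hc : ∀ k : ℕ, |c k| ≤ C * ((k : ℝ) + 1) ^ m)
    (hq0 : 0 < q) (hq1 : q < 1) (hx : 0 < x) (n : ℕ) :
    0 ≤ (-1 : ℝ) ^ n * iteratedDeriv n (qPowSeries c q) x := by
  rw [iteratedDeriv_qPowSeries hq0 hq1 n hc hx, qPowSeries, ← tsum_mul_left]
  refine tsum_nonneg fun k => ?_
  have hl : 0 ≤ -Real.log q := by linarith [Real.log_neg hq0 hq1]
  have := hc0 k
  have hy := Real.rpow_pos_of_pos hq0 x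
  calc 0 ≤ (-Real.log q * (k + 1)) ^ n * c k * (q ^ x) ^ (k + 1) := by positivity
    _ = ((-1) * (Real.log q * (k + 1))) ^ n * c k * (q ^ x) ^ (k + 1) := by ring
    _ = _ := by rw [mul_pow]; ring

/-- The coefficients of `-log ∏ (1 - q^(j+1) y)` as a power series in `y`. -/
noncomputable def qPochhammerLogCoeff (q : ℝ) (k : ℕ) : ℝ :=
  q ^ (k + 1) / ((1 - q ^ (k + 1)) * (k + 1))

lemma qPochhammerLogCoeff_nonneg {q : ℝ} (hq0 : 0 < q) (hq1 : q < 1) (k : ℕ) :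
    0 ≤ qPochhammerLogCoeff q k := by
  have h : 0 < 1 - q ^ (k + 1) := sub_pos.2 (pow_lt_one₀ hq0.le hq1 k.succ_ne_zero)
  unfold qPochhammerLogCoeff
  positivity

lemma qPochhammerLogCoeff_le {q : ℝ} (hq0 : 0 < q) (hq1 : q < 1) (k : ℕ) :
    qPochhammerLogCoeff q k ≤ q ^ (k + 1) / (1 - q) := by
  have h : 0 < 1 - q := sub_pos.2 hq1
  have hp : q ^ (k + 1) ≤ q := pow_le_of_le_one hq0.le hq1.le k.succ_ne_zero
  have hk : (0 : ℝ) ≤ k := k.cast_nonneg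
  unfold qPochhammerLogCoeff
  gcongr
  nlinarith

lemma hasSum_log_one_sub_qpow_mul {q y : ℝ} (hq0 : 0 < q) (hq1 : q < 1) (hy0 : 0 ≤ y)
    (hy1 : y ≤ 1) :
    HasSum (fun j : ℕ => Real.log (1 - q ^ (j + 1) * y))
      (-∑' k : ℕ, qPochhammerLogCoeff q k * y ^ (k + 1)) := by
  let f : ℕ × ℕ → ℝ := fun p => (q ^ (p.2 + 1) * y) ^ (p.1 + 1) / (p.1 + 1)
  have hf : 0 ≤ f := fun p => by simp only [f, Pi.zero_apply]; positivity
  have hinner : ∀ k : ℕ, HasSum (fun j => f (k, j)) (qPochhammerLogCoeff q k * y ^ (k + 1)) := by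
    intro k
    have hp : q ^ (k + 1) < 1 := pow_lt_one₀ hq0.le hq1 k.succ_ne_zero
    have hne : 1 - q ^ (k + 1) ≠ 0 := (sub_pos.2 hp).ne'
    have hk : (k : ℝ) + 1 ≠ 0 := by positivity
    convert! (hasSum_geometric_of_lt_one (pow_nonneg hq0.le (k + 1)) hp).mul_left
      (q ^ (k + 1) * y ^ (k + 1) / (k + 1)) using 1
    · ext j
      simp only [f]
      ring
    · unfold qPochhammerLogCoeff
      field_simp
  have houter : Summable fun k : ℕ => qPochhammerLogCoeff q k * y ^ (k + 1) := by
    refine Summable.of_nonneg_of_le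
      (fun k => mul_nonneg (qPochhammerLogCoeff_nonneg hq0 hq1 k) (pow_nonneg hy0 _))
      (fun k => ?_) (((summable_nat_add_iff 1).2
        (summable_geometric_of_lt_one hq0.le hq1)).div_const (1 - q))
    exact (mul_le_of_le_one_right (qPochhammerLogCoeff_nonneg hq0 hq1 k)
      (pow_le_one₀ hy0 hy1)).trans (qPochhammerLogCoeff_le hq0 hq1 k)
  have hs : Summable f := by
    refine (summable_prod_of_nonneg hf).2 ⟨fun k => (hinner k).summable, ?_⟩
    simpa only [(hinner _).tsum_eq] using houter
  have hval : HasSum f (∑' k : ℕ, qPochhammerLogCoeff q k * y ^ (k + 1)) := by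
    rw [(hs.hasSum.prod_fiberwise hinner).tsum_eq]
    exact hs.hasSum
  have hswap := (Equiv.prodComm ℕ ℕ).hasSum_iff.2 hval
  have hlog : ∀ j : ℕ, HasSum (fun k => (f ∘ Equiv.prodComm ℕ ℕ) (j, k))
      (-Real.log (1 - q ^ (j + 1) * y)) := by
    intro j
    have hp : q ^ (j + 1) < 1 := pow_lt_one₀ hq0.le hq1 j.succ_ne_zero
    have hp0 : 0 ≤ q ^ (j + 1) := pow_nonneg hq0.le _
    have habs : |q ^ (j + 1) * y| < 1 := by
      rw [abs_of_nonneg (mul_nonneg hp0 hy0)]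
      exact (mul_le_of_le_one_right hp0 hy1).trans_lt hp
    have h := Real.hasSum_pow_div_log_of_abs_lt_one habs
    simpa only [f, Function.comp_apply, Equiv.prodComm_apply, Prod.swap_prod_mk] using h
  have h := (hswap.prod_fiberwise hlog).neg
  simpa only [neg_neg] using h

lemma log_qGamma_add_one {q x : ℝ} (hq0 : 0 < q) (hq1 : q < 1) (hx : 0 < x) :
    0 < qGamma q (x + 1) ∧ Real.log (qGamma q (x + 1)) = -x * Real.log (1 - q) -
      qPowSeries (qPochhammerLogCoeff q) q 0 + qPowSeries (qPochhammerLogCoeff q) q x := by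
  obtain ⟨hy0, hy1⟩ := rpow_mem_Ioo hq0 hq1 hx
  have h1q : 0 < 1 - q := sub_pos.2 hq1
  have hp : ∀ j : ℕ, q ^ (j + 1) < 1 := fun j => pow_lt_one₀ hq0.le hq1 j.succ_ne_zero
  have hnum : ∀ j : ℕ, 0 < 1 - q ^ (j + 1) := fun j => sub_pos.2 (hp j)
  have hden : ∀ j : ℕ, 0 < 1 - q ^ (j + 1) * q ^ x := fun j =>
    sub_pos.2 ((mul_le_of_le_one_right (by positivity) hy1.le).trans_lt (hp j))
  have hexp : ∀ j : ℕ, q ^ ((j : ℝ) + (x + 1)) = q ^ (j + 1) * q ^ x := by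
    intro j
    rw [← Real.rpow_natCast, ← Real.rpow_add hq0]
    congr 1
    push_cast
    ring
  have hsum : HasSum
      (fun j : ℕ => Real.log ((1 - q ^ (j + 1)) / (1 - q ^ ((j : ℝ) + (x + 1)))))
      (-qPowSeries (qPochhammerLogCoeff q) q 0 + qPowSeries (qPochhammerLogCoeff q) q x) := by
    have h := (hasSum_log_one_sub_qpow_mul hq0 hq1 zero_le_one le_rfl).sub
      (hasSum_log_one_sub_qpow_mul hq0 hq1 hy0.le hy1.le)
    convert! h using 1
    · ext j
      rw [hexp, Real.log_div (hnum j).ne' (hden j).ne', mul_one]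
    · simp [qPowSeries]
  have hprod := Real.rexp_tsum_eq_tprod
    (fun j : ℕ => show 0 < (1 - q ^ (j + 1)) / (1 - q ^ ((j : ℝ) + (x + 1))) by
      rw [hexp]; exact div_pos (hnum j) (hden j)) hsum.summable
  have hpow : 0 < (1 - q) ^ (1 - (x + 1)) := Real.rpow_pos_of_pos h1q _
  unfold qGamma
  rw [← hprod, hsum.tsum_eq]
  refine ⟨by positivity, ?_⟩
  rw [Real.log_mul hpow.ne' (Real.exp_ne_zero _), Real.log_exp, Real.log_rpow h1q]
  ring

lemma hasDerivAt_dilog {z : ℝ} (hz0 : 0 < z) (hz1 : z < 1) :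
    HasDerivAt dilog (-(Real.log (1 - z) / z)) z := by
  have hm : Measurable fun t : ℝ => Real.log (1 - t) / t :=
    (Real.measurable_log.comp (measurable_const.sub measurable_id)).div measurable_id
  refine (intervalIntegral.integral_hasDerivAt_right ?_
    hm.stronglyMeasurable.stronglyMeasurableAtFilter ?_).neg
  · rw [intervalIntegrable_iff_integrableOn_Ioc_of_le hz0.le]
    refine MeasureTheory.IntegrableOn.of_bound measure_Ioc_lt_top hm.aestronglyMeasurable
      (1 - z)⁻¹ ?_
    refine (MeasureTheory.ae_restrict_iff' measurableSet_Ioc).2 (Eventually.of_forall ?_)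
    rintro t ⟨ht0, htz⟩
    have h1z : 0 < 1 - z := sub_pos.2 hz1
    have h1t : 0 < 1 - t := by linarith
    have hlog := Real.one_sub_inv_le_log_of_pos h1t
    have hneg : Real.log (1 - t) ≤ 0 := Real.log_nonpos h1t.le (by linarith)
    rw [Real.norm_eq_abs, abs_div, abs_of_nonpos hneg, abs_of_pos ht0, div_le_iff₀ ht0]
    calc -Real.log (1 - t) ≤ (1 - t)⁻¹ - 1 := by linarith
      _ = (1 - t)⁻¹ * t := by field_simp; ring
      _ ≤ (1 - z)⁻¹ * t := by gcongr
  · exact ((continuousAt_const.sub continuousAt_id).log (sub_pos.2 hz1).ne').div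
      continuousAt_id hz0.ne'

/-- The coefficients of the derivative of `log f_{α,1}(·;q)` as a power series in `q^x`. -/
noncomputable def logDerivQfCoeff (α q : ℝ) (k : ℕ) : ℝ :=
  Real.log q * (k + 1) * qPochhammerLogCoeff q k + 1 / (k + 1) + (1 - α) * Real.log q

lemma logDerivQfCoeff_nonneg {α q : ℝ} (hq0 : 0 < q) (hq1 : q < 1) (hα : 1 ≤ α) (k : ℕ) :
    0 ≤ logDerivQfCoeff α q k := by
  have hp : q ^ (k + 1) < 1 := pow_lt_one₀ hq0.le hq1 k.succ_ne_zero
  have hp0 : 0 < q ^ (k + 1) := by positivity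
  have h1 : 0 < 1 - q ^ (k + 1) := sub_pos.2 hp
  have hk : (0 : ℝ) < (k : ℝ) + 1 := by positivity
  have hlog := Real.one_sub_inv_le_log_of_pos hp0
  rw [Real.log_pow] at hlog
  push_cast at hlog
  have hmul : 0 ≤ (k + 1) * Real.log q * q ^ (k + 1) + (1 - q ^ (k + 1)) := by
    have := mul_le_mul_of_nonneg_right hlog hp0.le
    rw [sub_mul, inv_mul_cancel₀ hp0.ne'] at this
    linarith
  have hα' : 0 ≤ (1 - α) * Real.log q :=
    mul_nonneg_of_nonpos_of_nonpos (by linarith) (Real.log_neg hq0 hq1).le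
  have heq : Real.log q * (k + 1) * qPochhammerLogCoeff q k + 1 / (k + 1) =
      ((k + 1) * Real.log q * q ^ (k + 1) + (1 - q ^ (k + 1))) /
        ((1 - q ^ (k + 1)) * (k + 1)) := by
    unfold qPochhammerLogCoeff
    field_simp
  unfold logDerivQfCoeff
  rw [heq]
  positivity

lemma abs_logDerivQfCoeff_le {α q : ℝ} (hq0 : 0 < q) (hq1 : q < 1) (hα : 1 ≤ α) (k : ℕ) :
    |logDerivQfCoeff α q k| ≤ (1 + (1 - α) * Real.log q) * ((k : ℝ) + 1) ^ 0 := by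
  have hk : (0 : ℝ) ≤ k := k.cast_nonneg
  have hl : Real.log q * (k + 1) * qPochhammerLogCoeff q k ≤ 0 :=
    mul_nonpos_of_nonpos_of_nonneg
      (mul_nonpos_of_nonpos_of_nonneg (Real.log_neg hq0 hq1).le (by positivity))
      (qPochhammerLogCoeff_nonneg hq0 hq1 k)
  have h1 : 1 / ((k : ℝ) + 1) ≤ 1 := by
    rw [div_le_one (by positivity)]
    linarith
  rw [abs_of_nonneg (logDerivQfCoeff_nonneg hq0 hq1 hα k), logDerivQfCoeff, pow_zero, mul_one]
  linarith

lemma abs_qPochhammerLogCoeff_le {q : ℝ} (hq0 : 0 < q) (hq1 : q < 1) (k : ℕ) :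
    |qPochhammerLogCoeff q k| ≤ 1 / (1 - q) * ((k : ℝ) + 1) ^ 0 := by
  have h : 0 < 1 - q := sub_pos.2 hq1
  rw [abs_of_nonneg (qPochhammerLogCoeff_nonneg hq0 hq1 k), pow_zero, mul_one]
  refine (qPochhammerLogCoeff_le hq0 hq1 k).trans ?_
  gcongr
  exact pow_le_one₀ hq0.le hq1.le

lemma qPowSeries_logDerivQfCoeff {α q x : ℝ} (hq0 : 0 < q) (hq1 : q < 1) (hx : 0 < x) :
    qPowSeries (logDerivQfCoeff α q) q x =
      qPowSeries (fun k => Real.log q * (k + 1) * qPochhammerLogCoeff q k) q x -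
        Real.log (1 - q ^ x) + (1 - α) * Real.log q * (q ^ x / (1 - q ^ x)) := by
  obtain ⟨hy0, hy1⟩ := rpow_mem_Ioo hq0 hq1 hx
  have hs : Summable fun k : ℕ =>
      Real.log q * (k + 1) * qPochhammerLogCoeff q k * (q ^ x) ^ (k + 1) := by
    refine summable_mul_pow_of_bound (C := |Real.log q| * (1 / (1 - q))) (m := 1)
      (fun k => ?_) hy0.le hy1
    have hk : (0 : ℝ) ≤ (k : ℝ) + 1 := by positivity
    have := abs_qPochhammerLogCoeff_le hq0 hq1 k
    rw [pow_zero, mul_one] at this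
    rw [abs_mul, abs_mul, abs_of_nonneg hk]
    calc |Real.log q| * (k + 1) * |qPochhammerLogCoeff q k|
        ≤ |Real.log q| * (k + 1) * (1 / (1 - q)) := by gcongr
      _ = _ := by ring
  have hlog := Real.hasSum_pow_div_log_of_abs_lt_one
    (show |q ^ x| < 1 by rwa [abs_of_pos hy0])
  have hgeom := ((hasSum_geometric_of_lt_one hy0.le hy1).mul_left
    ((1 - α) * Real.log q * q ^ x))
  refine (((hs.hasSum.add hlog).add hgeom).congr_fun ?_).tsum_eq.trans ?_
  · intro k
    unfold logDerivQfCoeff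
    ring
  · unfold qPowSeries
    ring

lemma log_qf {α q x : ℝ} (hq0 : 0 < q) (hq1 : q < 1) (hx : 0 < x) :
    Real.log (qf α 1 q x) = -x * Real.log (1 - q) -
      qPowSeries (qPochhammerLogCoeff q) q 0 + qPowSeries (qPochhammerLogCoeff q) q x +
      -dilog (1 - q ^ x) / Real.log q -
      (x + 1 - α) * (Real.log (1 - q ^ x) - Real.log (1 - q)) := by
  have h1y : 0 < 1 - q ^ x := sub_pos.2 (rpow_mem_Ioo hq0 hq1 hx).2
  have h1q : 0 < 1 - q := sub_pos.2 hq1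
  obtain ⟨hG, hlogG⟩ := log_qGamma_add_one hq0 hq1 hx
  unfold qf
  rw [Real.log_div (mul_ne_zero hG.ne' (Real.exp_ne_zero _))
      (Real.rpow_pos_of_pos (div_pos h1y h1q) _).ne',
    Real.log_mul hG.ne' (Real.exp_ne_zero _), Real.log_exp, hlogG,
    Real.log_rpow (div_pos h1y h1q), Real.log_div h1y.ne' h1q.ne']

lemma hasDerivAt_log_qf {α q x : ℝ} (hq0 : 0 < q) (hq1 : q < 1) (hx : 0 < x) :
    HasDerivAt (fun t => Real.log (qf α 1 q t)) (qPowSeries (logDerivQfCoeff α q) q x) x := by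
  obtain ⟨hy0, hy1⟩ := rpow_mem_Ioo hq0 hq1 hx
  have h1y : 0 < 1 - q ^ x := sub_pos.2 hy1
  have hL : Real.log q ≠ 0 := (Real.log_neg hq0 hq1).ne
  have hev : (fun t => Real.log (qf α 1 q t)) =ᶠ[𝓝 x] fun t => -t * Real.log (1 - q) -
      qPowSeries (qPochhammerLogCoeff q) q 0 + qPowSeries (qPochhammerLogCoeff q) q t +
      -dilog (1 - q ^ t) / Real.log q -
      (t + 1 - α) * (Real.log (1 - q ^ t) - Real.log (1 - q)) := by
    filter_upwards [lt_mem_nhds hx] with t ht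
    exact log_qf hq0 hq1 ht
  have hinner : HasDerivAt (fun t : ℝ => 1 - q ^ t) (-(Real.log q * 1 * q ^ x)) x :=
    ((hasDerivAt_id x).const_rpow hq0).const_sub 1
  have hdil := (hasDerivAt_dilog h1y (sub_lt_self 1 hy0)).comp x hinner
  have hlin : HasDerivAt (fun t : ℝ => t + 1 - α) 1 x :=
    ((hasDerivAt_id x).add_const 1).sub_const α
  have hser := hasDerivAt_qPowSeries (abs_qPochhammerLogCoeff_le hq0 hq1) hq0 hq1 hx
  refine HasDerivAt.congr_of_eventuallyEq ?_ hev
  convert! ((((((hasDerivAt_id x).neg.mul_const (Real.log (1 - q))).sub_const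
    (qPowSeries (qPochhammerLogCoeff q) q 0)).add hser).add
      (hdil.neg.div_const (Real.log q))).sub
        (hlin.mul ((hinner.log h1y.ne').sub_const (Real.log (1 - q))))) using 1
  rw [qPowSeries_logDerivQfCoeff hq0 hq1 hx, sub_sub_cancel, Real.log_rpow hq0]
  field_simp
  ring

/-- If `0 < q < 1` and `α ≥ 1`, then `1/f_{α,1}(·;q)` is logarithmically completely
monotonic on `(0,∞)`: for every `n ≥ 1` and `x > 0`,
`(−1)^n (−log f_{α,1}(·;q))^{(n)}(x) ≥ 0`. -/
theorem logCompletelyMonotonic_inv_qf_of_one_le_alpha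
    (q α : ℝ) (hq0 : 0 < q) (hq1 : q < 1) (hα : 1 ≤ α) :
    ∀ n : ℕ, 1 ≤ n → ∀ x : ℝ, 0 < x →
      0 ≤ (-1 : ℝ) ^ n * iteratedDeriv n (fun t => -Real.log (qf α 1 q t)) x := by
  intro n hn x hx
  obtain ⟨n, rfl⟩ := Nat.exists_eq_add_of_le' hn
  have hev : deriv (fun t => -Real.log (qf α 1 q t)) =ᶠ[𝓝 x]
      -qPowSeries (logDerivQfCoeff α q) q := by
    filter_upwards [lt_mem_nhds hx] with t ht
    exact (hasDerivAt_log_qf hq0 hq1 ht).neg.deriv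
  rw [iteratedDeriv_succ', hev.iteratedDeriv_eq, iteratedDeriv_neg, pow_succ, mul_neg_one,
    neg_mul_neg]
  exact neg_one_pow_mul_iteratedDeriv_qPowSeries_nonneg (logDerivQfCoeff_nonneg hq0 hq1 hα)
    (abs_logDerivQfCoeff_le hq0 hq1 hα) hq0 hq1 hx n
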